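/- arXiv:2104.12912 — 8 statements merged into one kernel-verified Lean document; each statement's English description precedes it below -/
import Mathlib

section
/- Fix λ ∈ [0,1). The function ξ(x) = ½Z(x) − λ·ln(Z(x) + x − 2λ) − ln((Z(x) − λx + 2)/x) is differentiable on (0,∞) and its derivative satisfies ξ′(x) = Z(x)/(2x) for every x > 0; equivalently ξ′(x) = √f(x) where f(x) = (x² − 4λx + 4)/(4x²). -/
/-- For `λ ∈ [0,1)`, the function
`ξ(x) = ½Z(x) − λ ln(Z(x)+x−2λ) − ln((Z(x)−λx+2)/x)` is differentiable on `(0,∞)`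
with `ξ′(x) = Z(x)/(2x)`, equivalently `ξ′(x) = √f(x)` where
`f(x) = (x² − 4λx + 4)/(4x²)`. -/
theorem stmt_2 (l : ℝ) (hl0 : 0 ≤ l) (hl1 : l < 1)
    (Z ξ : ℝ → ℝ)
    (hZ : ∀ x : ℝ, Z x = Real.sqrt (x ^ 2 - 4 * l * x + 4))
    (hξ : ∀ x : ℝ, ξ x = (1 / 2) * Z x - l * Real.log (Z x + x - 2 * l)
      - Real.log ((Z x - l * x + 2) / x)) :
    ∀ x : ℝ, 0 < x →
      HasDerivAt ξ (Z x / (2 * x)) x ∧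
      Z x / (2 * x) = Real.sqrt ((x ^ 2 - 4 * l * x + 4) / (4 * x ^ 2)) := by
  intro x hx
  have hl2 : 0 < 1 - l ^ 2 := by nlinarith
  have hq : 0 < x ^ 2 - 4 * l * x + 4 := by nlinarith [sq_nonneg (x - 2 * l)]
  have hZpos : 0 < Z x := by rw [hZ]; exact Real.sqrt_pos.2 hq
  have hZsq : Z x ^ 2 = x ^ 2 - 4 * l * x + 4 := by rw [hZ]; exact Real.sq_sqrt hq.le
  have hA : 0 < Z x + x - 2 * l := by
    have h : |2 * l - x| < Z x := abs_lt_of_sq_lt_sq (by nlinarith) hZpos.le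
    linarith [le_abs_self (2 * l - x)]
  have hB : 0 < Z x - l * x + 2 := by
    have h : |l * x - 2| < Z x :=
      abs_lt_of_sq_lt_sq (by nlinarith [mul_pos hl2 (pow_pos hx 2)]) hZpos.le
    linarith [le_abs_self (l * x - 2)]
  refine ⟨?_, ?_⟩
  · have hZd : HasDerivAt Z ((x - 2 * l) / Z x) x := by
      have hp : HasDerivAt (fun y : ℝ => y ^ 2 - 4 * l * y + 4) (2 * x - 4 * l) x := by
        simpa using
          (((hasDerivAt_id x).pow 2).sub ((hasDerivAt_id x).const_mul (4 * l))).add_const 4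
      have h := hp.sqrt hq.ne'
      rw [← hZ x, ← funext hZ] at h
      convert h using 1
      field_simp
      ring
    have hAd : HasDerivAt (fun y => Real.log (Z y + y - 2 * l)) (1 / Z x) x := by
      convert ((hZd.fun_add (hasDerivAt_id' x)).sub_const (2 * l)).log hA.ne' using 1
      field_simp
      ring
    have hBd : HasDerivAt (fun y => Real.log ((Z y - l * y + 2) / y))
        ((Z x - 2) / (x * Z x) - 1 / x) x := by
      have hN : HasDerivAt (fun y => Z y - l * y + 2) ((x - 2 * l) / Z x - l) x := by
        simpa using (hZd.sub ((hasDerivAt_id x).const_mul l)).add_const 2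
      convert (hN.fun_div (hasDerivAt_id' x) hx.ne').log (div_pos hB hx).ne' using 1
      have hB' : Z x - x * l + 2 ≠ 0 := by rw [mul_comm x l]; exact hB.ne'
      field_simp
      linear_combination hZsq
    rw [funext hξ]
    refine (((hZd.const_mul (1 / 2)).fun_sub (hAd.const_mul l)).fun_sub hBd).congr_deriv ?_
    field_simp
    linear_combination -hZsq
  · rw [Real.sqrt_div hq.le, ← hZ, show 4 * x ^ 2 = (2 * x) ^ 2 by ring,
      Real.sqrt_sq (by positivity)]
end

section
/- Fix λ ∈ [0,1). As x → 0⁺, ξ(x) = ln(x/4) + 1 − λ·ln(2 − 2λ) + O(x); that is, the function x ↦ ξ(x) − ln(x/4) − 1 + λ·ln(2 − 2λ) is O(x) as x → 0 from the right. -/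
open Filter Asymptotics

/-- For `λ ∈ [0,1)`, as `x → 0⁺`,
`ξ(x) = ln(x/4) + 1 − λ ln(2 − 2λ) + O(x)`. -/
theorem stmt_3 (l : ℝ) (hl0 : 0 ≤ l) (hl1 : l < 1)
    (Z ξ : ℝ → ℝ)
    (hZ : ∀ x : ℝ, Z x = Real.sqrt (x ^ 2 - 4 * l * x + 4))
    (hξ : ∀ x : ℝ, ξ x = (1 / 2) * Z x - l * Real.log (Z x + x - 2 * l)
      - Real.log ((Z x - l * x + 2) / x)) :
    (fun x : ℝ => ξ x - Real.log (x / 4) - 1 + l * Real.log (2 - 2 * l))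
      =O[nhdsWithin 0 (Set.Ioi 0)] (fun x : ℝ => x) := by
  have hZ0 : Z 0 = 2 := by
    rw [hZ, show (0 : ℝ) ^ 2 - 4 * l * 0 + 4 = 2 ^ 2 by norm_num]
    exact Real.sqrt_sq (by norm_num)
  have hZd : DifferentiableAt ℝ Z 0 := by
    rw [funext hZ]
    exact DifferentiableAt.sqrt (by fun_prop) (by norm_num)
  have hd : DifferentiableAt ℝ (fun x => (1 / 2) * Z x - l * Real.log (Z x + x - 2 * l)
      - Real.log (Z x - l * x + 2)) 0 := by
    refine ((hZd.const_mul _).sub (DifferentiableAt.const_mul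
      (DifferentiableAt.log (by fun_prop) ?_) _)).sub (DifferentiableAt.log (by fun_prop) ?_)
    · rw [hZ0]; linarith
    · rw [hZ0]; norm_num
  have hne : ∀ᶠ x in nhds (0 : ℝ), Z x - l * x + 2 ≠ 0 := by
    have hc : ContinuousAt (fun x => Z x - l * x + 2) 0 :=
      ((hZd.sub (by fun_prop)).add_const _).continuousAt
    exact hc.eventually_ne (by rw [hZ0]; norm_num)
  refine (hd.isBigO_sub.mono nhdsWithin_le_nhds).congr' ?_ (by simp)
  filter_upwards [nhdsWithin_le_nhds hne, self_mem_nhdsWithin] with x hx hx0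
  have hx0' : x ≠ 0 := ne_of_gt hx0
  rw [hξ, hZ0, Real.log_div hx hx0', Real.log_div hx0' (by norm_num)]
  norm_num
  ring
end

section
/- Fix λ ∈ [0,1). As x → +∞, ξ(x) = x/2 − λ·ln(2x) − λ − ln(1 − λ) + O(1/x); that is, the function x ↦ ξ(x) − x/2 + λ·ln(2x) + λ + ln(1 − λ) is O(1/x) as x → +∞. -/
open Filter Asymptotics

theorem abs_log_one_add_le {u : ℝ} (hu : |u| ≤ 1 / 2) : |Real.log (1 + u)| ≤ 2 * |u| := by
  obtain ⟨h1, h2⟩ := abs_le.mp hu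
  have hpos : 0 < 1 + u := by linarith
  have hup := Real.log_le_sub_one_of_pos hpos
  have hlo := Real.one_sub_inv_le_log_of_pos hpos
  have hinv : 1 - (1 + u)⁻¹ = u / (1 + u) := by field_simp; ring
  have hbd : -(2 * |u|) ≤ u / (1 + u) := by
    rw [le_div_iff₀ hpos]
    nlinarith [neg_abs_le u, abs_nonneg u]
  rw [abs_le]
  constructor
  · linarith
  · linarith [le_abs_self u, abs_nonneg u]

/-- For `λ ∈ [0,1)`, as `x → +∞`,
`ξ(x) = x/2 − λ ln(2x) − λ − ln(1 − λ) + O(1/x)`. -/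
theorem stmt_4 (l : ℝ) (hl0 : 0 ≤ l) (hl1 : l < 1)
    (Z ξ : ℝ → ℝ)
    (hZ : ∀ x : ℝ, Z x = Real.sqrt (x ^ 2 - 4 * l * x + 4))
    (hξ : ∀ x : ℝ, ξ x = (1 / 2) * Z x - l * Real.log (Z x + x - 2 * l)
      - Real.log ((Z x - l * x + 2) / x)) :
    (fun x : ℝ => ξ x - x / 2 + l * Real.log (2 * x) + l + Real.log (1 - l))
      =O[atTop] (fun x : ℝ => 1 / x) := by
  have hm : 0 < 1 - l := by linarith
  refine IsBigO.of_bound (2 + 4 + 6 / (1 - l)) ?_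
  filter_upwards [eventually_ge_atTop 4, eventually_ge_atTop (6 / (1 - l))] with x hx4 hx6
  rw [div_le_iff₀ hm] at hx6
  have hx : 0 < x := by linarith
  have hxm : 0 < x * (1 - l) := by positivity
  obtain ⟨d, hd⟩ : ∃ d, d = Z x - (x - 2 * l) := ⟨_, rfl⟩
  have hZd : Z x = x - 2 * l + d := by linarith
  have hsq : Z x ^ 2 = (x - 2 * l) ^ 2 + 4 * (1 - l ^ 2) := by
    rw [hZ, Real.sq_sqrt (by nlinarith [sq_nonneg (x - 2 * l)])]; ring
  have hd0 : 0 ≤ d := by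
    have : x - 2 * l ≤ Z x := by
      rw [hZ]; exact Real.le_sqrt_of_sq_le (by nlinarith)
    linarith
  have hdx : d * x ≤ 4 := by
    rw [hZd] at hsq
    nlinarith [mul_nonneg hd0 (by linarith : 0 ≤ x - 4 * l), sq_nonneg d, sq_nonneg l]
  have hd4 : d ≤ 4 / x := (le_div_iff₀ hx).mpr hdx
  have hd1 : d ≤ 1 := by nlinarith
  have hu : |(d - 4 * l) / (2 * x)| ≤ 2 / x := by
    rw [abs_div, abs_of_pos (by positivity : 0 < 2 * x), div_le_div_iff₀ (by positivity) hx]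
    have : |d - 4 * l| ≤ 4 := abs_le.mpr ⟨by linarith, by linarith⟩
    nlinarith
  have hv : |(d - 2 * l + 2) / (x * (1 - l))| ≤ 3 / (x * (1 - l)) := by
    rw [abs_div, abs_of_pos hxm]
    gcongr
    exact abs_le.mpr ⟨by linarith, by linarith⟩
  have hlu := abs_log_one_add_le (hu.trans (by rw [div_le_div_iff₀ hx two_pos]; linarith))
  have hlv := abs_log_one_add_le (hv.trans (by rw [div_le_div_iff₀ hxm two_pos]; linarith))
  have hlogu : Real.log (1 + (d - 4 * l) / (2 * x))
      = Real.log (Z x + x - 2 * l) - Real.log (2 * x) := by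
    rw [← Real.log_div (by linarith) (by positivity), hZd]
    congr 1
    field_simp
    ring
  have hlogv : Real.log (1 + (d - 2 * l + 2) / (x * (1 - l)))
      = Real.log ((Z x - l * x + 2) / x) - Real.log (1 - l) := by
    have : 0 < Z x - l * x + 2 := by rw [hZd]; linarith
    rw [← Real.log_div (by positivity) hm.ne', hZd]
    congr 1
    field_simp
    ring
  have hsplit : ξ x - x / 2 + l * Real.log (2 * x) + l + Real.log (1 - l)
      = d / 2 - l * Real.log (1 + (d - 4 * l) / (2 * x))
        - Real.log (1 + (d - 2 * l + 2) / (x * (1 - l))) := by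
    rw [hξ, hlogu, hlogv, hd]; ring
  have hbound : (2 + 4 + 6 / (1 - l)) * (1 / x)
      = 4 / x / 2 + 2 * (2 / x) + 2 * (3 / (x * (1 - l))) := by
    field_simp
    ring
  have hl_log : |l * Real.log (1 + (d - 4 * l) / (2 * x))| ≤ 2 * (2 / x) := by
    rw [abs_mul, abs_of_nonneg hl0]
    nlinarith [abs_nonneg (Real.log (1 + (d - 4 * l) / (2 * x)))]
  rw [Real.norm_eq_abs, Real.norm_eq_abs, abs_of_pos (by positivity : 0 < 1 / x), hsplit, hbound]
  obtain ⟨a1, a2⟩ := abs_le.mp hl_log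
  obtain ⟨b1, b2⟩ := abs_le.mp (hlv.trans (mul_le_mul_of_nonneg_left hv two_pos.le))
  exact abs_le.mpr ⟨by linarith, by linarith⟩
end

section
/- Fix λ ∈ [0,1). The function ξ is strictly increasing on (0,∞), ξ(x) → −∞ as x → 0⁺, ξ(x) → +∞ as x → +∞, and ξ maps (0,∞) bijectively onto ℝ. -/
open Filter

lemma sq_sub_mul_add_pos {l : ℝ} (hl0 : 0 ≤ l) (hl1 : l < 1) (x : ℝ) :
    0 < x ^ 2 - 4 * l * x + 4 := by
  nlinarith [sq_nonneg (x - 2 * l)]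

lemma sqrt_add_sub_pos {l : ℝ} (hl0 : 0 ≤ l) (hl1 : l < 1) (x : ℝ) :
    0 < √(x ^ 2 - 4 * l * x + 4) + x - 2 * l := by
  have h : 2 * l - x < √(x ^ 2 - 4 * l * x + 4) := Real.lt_sqrt_of_sq_lt (by nlinarith)
  linarith

lemma sqrt_sub_mul_add_pos {l x : ℝ} (hl0 : 0 ≤ l) (hl1 : l < 1) (hx : 0 < x) :
    0 < √(x ^ 2 - 4 * l * x + 4) - l * x + 2 := by
  have h : l * x - 2 < √(x ^ 2 - 4 * l * x + 4) := by
    apply Real.lt_sqrt_of_sq_lt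
    have : 0 < (1 - l) * (1 + l) * x ^ 2 :=
      mul_pos (mul_pos (by linarith) (by linarith)) (by positivity)
    nlinarith
  linarith

/-- The phase function has derivative `Z / (2 x)` on the positive half-line. -/
lemma hasDerivAt_phase {l x : ℝ} (hl0 : 0 ≤ l) (hl1 : l < 1) (hx : 0 < x) :
    HasDerivAt (fun x ↦ 1 / 2 * √(x ^ 2 - 4 * l * x + 4)
      - l * Real.log (√(x ^ 2 - 4 * l * x + 4) + x - 2 * l)
      - Real.log ((√(x ^ 2 - 4 * l * x + 4) - l * x + 2) / x))
      (√(x ^ 2 - 4 * l * x + 4) / (2 * x)) x := by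
  have hQ := sq_sub_mul_add_pos hl0 hl1 x
  have hA := sqrt_add_sub_pos hl0 hl1 x
  have hB := sqrt_sub_mul_add_pos hl0 hl1 hx
  have hq : HasDerivAt (fun x : ℝ ↦ x ^ 2 - 4 * l * x + 4) (2 * x - 4 * l) x := by
    simpa using (((hasDerivAt_id x).pow 2).sub ((hasDerivAt_id x).const_mul (4 * l))).add_const 4
  have hZ := hq.sqrt hQ.ne'
  have hlog₁ := ((hZ.add (hasDerivAt_id x)).sub_const (2 * l)).log hA.ne'
  have hlog₂ := (((hZ.sub ((hasDerivAt_id x).const_mul l)).add_const 2).div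
    (hasDerivAt_id x) hx.ne').log (div_pos hB hx).ne'
  refine (((hZ.const_mul (1 / 2)).sub (hlog₁.const_mul l)).sub hlog₂).congr_deriv ?_
  have hz : 0 < √(x ^ 2 - 4 * l * x + 4) := Real.sqrt_pos.2 hQ
  have hsq := Real.sq_sqrt hQ.le
  simp only [Pi.add_apply, Pi.sub_apply, Pi.div_apply, id_eq]
  generalize √(x ^ 2 - 4 * l * x + 4) = z at *
  have h₁ : ((2 * x - 4 * l) / (2 * z) + 1) / (z + x - 2 * l) = 1 / z := by
    field_simp
    ring
  have h₂ : (((2 * x - 4 * l) / (2 * z) - l * 1) * x - (z - l * x + 2) * 1) / x ^ 2 /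
      ((z - l * x + 2) / x) = -2 / (x * z) := by
    rw [div_div, div_eq_div_iff (by positivity) (by positivity)]
    field_simp
    linear_combination (-2) * hsq
  rw [h₁, h₂]
  field_simp
  linear_combination (-2) * hsq

theorem stmt_5 (l : ℝ) (hl0 : 0 ≤ l) (hl1 : l < 1)
    (Z ξ : ℝ → ℝ)
    (hZ : ∀ x : ℝ, Z x = Real.sqrt (x ^ 2 - 4 * l * x + 4))
    (hξ : ∀ x : ℝ, ξ x = (1 / 2) * Z x - l * Real.log (Z x + x - 2 * l)
      - Real.log ((Z x - l * x + 2) / x)) :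
    StrictMonoOn ξ (Set.Ioi 0) ∧
    Tendsto ξ (nhdsWithin 0 (Set.Ioi 0)) atBot ∧
    Tendsto ξ atTop atTop ∧
    Set.BijOn ξ (Set.Ioi 0) Set.univ := by
  obtain rfl : Z = _ := funext hZ
  obtain rfl : ξ = _ := funext hξ
  clear hZ hξ
  set ξ : ℝ → ℝ := fun x ↦ 1 / 2 * √(x ^ 2 - 4 * l * x + 4)
      - l * Real.log (√(x ^ 2 - 4 * l * x + 4) + x - 2 * l)
      - Real.log ((√(x ^ 2 - 4 * l * x + 4) - l * x + 2) / x) with hξ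
  have hderiv : ∀ x, 0 < x → HasDerivAt ξ (√(x ^ 2 - 4 * l * x + 4) / (2 * x)) x :=
    fun x hx ↦ hasDerivAt_phase hl0 hl1 hx
  have hcont : ContinuousOn ξ (Set.Ioi 0) :=
    fun x hx ↦ (hderiv x hx).continuousAt.continuousWithinAt
  have hmono : StrictMonoOn ξ (Set.Ioi 0) := by
    refine strictMonoOn_of_deriv_pos (convex_Ioi 0) hcont fun x hx ↦ ?_
    rw [interior_Ioi] at hx
    have hx : 0 < x := hx
    rw [(hderiv x hx).deriv]
    have := Real.sqrt_pos.2 (sq_sub_mul_add_pos hl0 hl1 x)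
    positivity
  have hbot : Tendsto ξ (nhdsWithin 0 (Set.Ioi 0)) atBot := by
    have hg : ContinuousAt (fun x : ℝ ↦ 1 / 2 * √(x ^ 2 - 4 * l * x + 4)
        - l * Real.log (√(x ^ 2 - 4 * l * x + 4) + x - 2 * l)
        - Real.log (√(x ^ 2 - 4 * l * x + 4) - l * x + 2)) 0 := by
      have hA := sqrt_add_sub_pos hl0 hl1 0
      have hB : √((0 : ℝ) ^ 2 - 4 * l * 0 + 4) - l * 0 + 2 ≠ 0 := by
        rw [mul_zero l, sub_zero]
        positivity
      have hA' := hA.ne'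
      fun_prop (disch := assumption)
    refine ((hg.tendsto.mono_left nhdsWithin_le_nhds).add_atBot
      Real.tendsto_log_nhdsGT_zero).congr' ?_
    filter_upwards [self_mem_nhdsWithin] with x hx
    have hx : 0 < x := hx
    rw [hξ]
    dsimp only
    rw [Real.log_div (sqrt_sub_mul_add_pos hl0 hl1 hx).ne' hx.ne']
    ring
  have htop : Tendsto ξ atTop atTop := by
    set c : ℝ := √((1 - l) * (1 + l)) with hc
    have hc0 : 0 < c := Real.sqrt_pos.2 (mul_pos (by linarith) (by linarith))
    have hc2 : c ^ 2 = (1 - l) * (1 + l) :=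
      Real.sq_sqrt (mul_nonneg (by linarith) (by linarith))
    have hd : ∀ x, 0 < x → HasDerivAt (fun x ↦ ξ x - c / 2 * x)
        (√(x ^ 2 - 4 * l * x + 4) / (2 * x) - c / 2) x := fun x hx ↦ by
      have h := (hderiv x hx).sub ((hasDerivAt_id x).const_mul (c / 2))
      rwa [mul_one] at h
    have hm : MonotoneOn (fun x ↦ ξ x - c / 2 * x) (Set.Ioi 0) := by
      refine monotoneOn_of_deriv_nonneg (convex_Ioi 0)
        (fun x hx ↦ (hd x hx).continuousAt.continuousWithinAt) ?_ ?_ <;> rw [interior_Ioi]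
      · exact fun x hx ↦ (hd x hx).differentiableAt.differentiableWithinAt
      · intro x hx
        have hx : 0 < x := hx
        rw [(hd x hx).deriv, sub_nonneg, le_div_iff₀ (by positivity)]
        apply Real.le_sqrt_of_sq_le
        have : (c / 2 * (2 * x)) ^ 2 = (1 - l) * (1 + l) * x ^ 2 := by rw [← hc2]; ring
        nlinarith [sq_nonneg (l * x - 2)]
    refine tendsto_atTop_mono' atTop ?_ (tendsto_atTop_add_const_left atTop (ξ 1 - c / 2 * 1)
      (tendsto_id.const_mul_atTop (half_pos hc0)))
    filter_upwards [eventually_ge_atTop 1] with x hx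
    have := hm (Set.mem_Ioi.2 one_pos) (Set.mem_Ioi.2 (one_pos.trans_le hx)) hx
    simp only [id_eq] at this ⊢
    linarith
  exact ⟨hmono, hbot, htop, Set.mapsTo_univ _ _, hmono.injOn,
    isPreconnected_Ioi.intermediate_value_Iii
      (l₁ := nhdsWithin 0 (Set.Ioi 0)) inf_le_right
      (le_principal_iff.2 (Ioi_mem_atTop 0)) hcont hbot htop⟩
end

section
/- Fix λ ∈ [0,1). Then ∫₀^∞ (t⁵ + 2λt⁴ + 8(λ² − 5)t³ − 8λ(λ² − 9)t² − 16(5λ² − 4)t − 32λ)/(t² − 4λt + 4)⁴ dt = 0; the integrand is integrable on (0,∞) and the integral vanishes. (This expresses that the coefficient Ê₂(z) = ½∫_∞^z Z(t)F̂₂(t)/t dt satisfies Ê₂(0) = 0.) -/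
open MeasureTheory

theorem one_sub_mul_one_add_sq_le {l : ℝ} (hl0 : 0 ≤ l) (hl1 : l < 1) (t : ℝ) :
    (1 - l) * (1 + t ^ 2) ≤ t ^ 2 - 4 * l * t + 4 := by
  nlinarith [mul_nonneg hl0 (sq_nonneg (t - 2))]

theorem quadratic_pos {l : ℝ} (hl0 : 0 ≤ l) (hl1 : l < 1) (t : ℝ) :
    0 < t ^ 2 - 4 * l * t + 4 :=
  (mul_pos (sub_pos.2 hl1) (by positivity)).trans_le (one_sub_mul_one_add_sq_le hl0 hl1 t)

theorem abs_div_quadratic_pow_le {l : ℝ} (hl0 : 0 ≤ l) (hl1 : l < 1) {n : ℕ} {C p t : ℝ}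
    (hp : |p| ≤ C * (1 + t ^ 2) ^ n) :
    |p / (t ^ 2 - 4 * l * t + 4) ^ (n + 1)| ≤ C / (1 - l) ^ (n + 1) * (1 + t ^ 2)⁻¹ := by
  have h1 : 0 < 1 - l := sub_pos.2 hl1
  have hs : 0 < 1 + t ^ 2 := by positivity
  rw [abs_div, abs_of_pos (pow_pos (quadratic_pos hl0 hl1 t) _)]
  calc |p| / (t ^ 2 - 4 * l * t + 4) ^ (n + 1)
      ≤ (C * (1 + t ^ 2) ^ n) / ((1 - l) * (1 + t ^ 2)) ^ (n + 1) :=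
        div_le_div₀ ((abs_nonneg p).trans hp) hp (by positivity)
          (pow_le_pow_left₀ (by positivity) (one_sub_mul_one_add_sq_le hl0 hl1 t) _)
    _ = C / (1 - l) ^ (n + 1) * (1 + t ^ 2)⁻¹ := by
        rw [mul_pow, pow_succ (1 + t ^ 2)]
        field_simp

theorem abs_numerator_le {l t : ℝ} (hl0 : 0 ≤ l) (hl1 : l < 1) (ht : 0 ≤ t) :
    |t ^ 5 + 2 * l * t ^ 4 + 8 * (l ^ 2 - 5) * t ^ 3 - 8 * l * (l ^ 2 - 9) * t ^ 2
        - 16 * (5 * l ^ 2 - 4) * t - 32 * l| ≤ 211 * (1 + t ^ 2) ^ 3 := by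
  have hs1 : 1 ≤ 1 + t ^ 2 := by nlinarith
  have hs2 : t ≤ 1 + t ^ 2 := by nlinarith [sq_nonneg (t - 1)]
  have hs3 : t ^ 2 ≤ 1 + t ^ 2 := by linarith
  set s := 1 + t ^ 2
  have hss : s ≤ s ^ 3 := le_self_pow₀ hs1 (by norm_num)
  have hs23 : s ^ 2 ≤ s ^ 3 := pow_le_pow_right₀ hs1 (by norm_num)
  have b4 : t ^ 4 ≤ s ^ 2 := by
    calc t ^ 4 = (t ^ 2) ^ 2 := by ring
      _ ≤ s ^ 2 := by gcongr
  have b5 : t ^ 5 ≤ s ^ 3 := by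
    calc t ^ 5 = t ^ 4 * t := by ring
      _ ≤ s ^ 2 * s := by gcongr
      _ = s ^ 3 := by ring
  have b3 : t ^ 3 ≤ s ^ 3 := by gcongr
  have key : ∀ {c x K : ℝ}, |c| ≤ K → 0 ≤ x → x ≤ s ^ 3 → |c * x| ≤ K * s ^ 3 := by
    intro c x K hc hx hxs
    rw [abs_mul, abs_of_nonneg hx]
    exact mul_le_mul hc hxs hx ((abs_nonneg c).trans hc)
  have hl2 : l ^ 2 ≤ 1 := pow_le_one₀ hl0 hl1.le
  have hl2' : 0 ≤ l ^ 2 := sq_nonneg l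
  have c5 := abs_le.1 (key (c := 1) (K := 1) (by norm_num) (by positivity) b5)
  have c4 := abs_le.1 (key (c := 2 * l) (K := 2)
    (abs_le.2 ⟨by linarith, by linarith⟩) (by positivity) (b4.trans hs23))
  have c3 := abs_le.1 (key (c := 8 * (l ^ 2 - 5)) (K := 40)
    (abs_le.2 ⟨by linarith, by linarith⟩) (by positivity) b3)
  have c2 := abs_le.1 (key (c := 8 * l * (l ^ 2 - 9)) (K := 72)
    (abs_le.2 ⟨by nlinarith, by nlinarith⟩) (by positivity) (hs3.trans hss))
  have c1 := abs_le.1 (key (c := 16 * (5 * l ^ 2 - 4)) (K := 64)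
    (abs_le.2 ⟨by linarith, by linarith⟩) ht (hs2.trans hss))
  have c0 := abs_le.1 (key (c := 32 * l) (K := 32)
    (abs_le.2 ⟨by linarith, by linarith⟩) zero_le_one (hs1.trans hss))
  exact abs_le.2 ⟨by linarith [c5.1, c4.1, c3.1, c2.2, c1.2, c0.2],
    by linarith [c5.2, c4.2, c3.2, c2.1, c1.1, c0.1]⟩

theorem abs_primitive_numerator_le {l : ℝ} (hl0 : 0 ≤ l) (hl1 : l < 1) (t : ℝ) :
    |-t ^ 4 / 2 + (8 - 2 * l ^ 2) * t ^ 2 - 8 * l * t| ≤ 16 * (1 + t ^ 2) ^ 2 := by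
  have hlt : |l * t| ≤ 1 + t ^ 2 := by
    rw [abs_le]
    constructor <;> nlinarith [sq_nonneg (l - t), sq_nonneg (l + t)]
  obtain ⟨h1, h2⟩ := abs_le.1 hlt
  have hl2 : l ^ 2 * t ^ 2 ≤ t ^ 2 :=
    mul_le_of_le_one_left (sq_nonneg t) (pow_le_one₀ hl0 hl1.le)
  have hl2' : 0 ≤ l ^ 2 * t ^ 2 := by positivity
  rw [abs_le]
  constructor <;> nlinarith [sq_nonneg t, sq_nonneg (t ^ 2)]

theorem hasDerivAt_primitive {l : ℝ} (hl0 : 0 ≤ l) (hl1 : l < 1) (t : ℝ) :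
    HasDerivAt (fun t : ℝ => (-t ^ 4 / 2 + (8 - 2 * l ^ 2) * t ^ 2 - 8 * l * t) /
        (t ^ 2 - 4 * l * t + 4) ^ 3)
      ((t ^ 5 + 2 * l * t ^ 4 + 8 * (l ^ 2 - 5) * t ^ 3 - 8 * l * (l ^ 2 - 9) * t ^ 2
        - 16 * (5 * l ^ 2 - 4) * t - 32 * l) / (t ^ 2 - 4 * l * t + 4) ^ 4) t := by
  have hD := (quadratic_pos hl0 hl1 t).ne'
  have hnum : HasDerivAt (fun t : ℝ => -t ^ 4 / 2 + (8 - 2 * l ^ 2) * t ^ 2 - 8 * l * t)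
      (-2 * t ^ 3 + (8 - 2 * l ^ 2) * (2 * t) - 8 * l) t := by
    refine HasDerivAt.congr_deriv ((((hasDerivAt_pow 4 t).neg.div_const 2).add
      ((hasDerivAt_pow 2 t).const_mul (8 - 2 * l ^ 2))).sub
      ((hasDerivAt_id t).const_mul (8 * l))) ?_
    norm_num
    ring
  have hden : HasDerivAt (fun t : ℝ => t ^ 2 - 4 * l * t + 4) (2 * t - 4 * l) t := by
    refine HasDerivAt.congr_deriv
      (((hasDerivAt_pow 2 t).sub ((hasDerivAt_id t).const_mul (4 * l))).add_const 4) ?_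
    norm_num
  refine HasDerivAt.congr_deriv (hnum.div (hden.pow 3) (pow_ne_zero 3 hD)) ?_
  rw [div_eq_div_iff (pow_ne_zero 2 (pow_ne_zero 3 hD)) (pow_ne_zero 4 hD)]
  push_cast
  ring

theorem tendsto_primitive {l : ℝ} (hl0 : 0 ≤ l) (hl1 : l < 1) :
    Filter.Tendsto (fun t : ℝ => (-t ^ 4 / 2 + (8 - 2 * l ^ 2) * t ^ 2 - 8 * l * t) /
        (t ^ 2 - 4 * l * t + 4) ^ 3) Filter.atTop (nhds 0) := by
  refine squeeze_zero_norm
    (fun t => abs_div_quadratic_pow_le hl0 hl1 (abs_primitive_numerator_le hl0 hl1 t)) ?_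
  rw [← mul_zero (16 / (1 - l) ^ (2 + 1))]
  exact (tendsto_inv_atTop_zero.comp (Filter.tendsto_atTop_add_const_left _ 1
    (Filter.tendsto_pow_atTop two_ne_zero))).const_mul _

/-- For `λ ∈ [0,1)`,
`∫₀^∞ (t⁵ + 2λt⁴ + 8(λ²−5)t³ − 8λ(λ²−9)t² − 16(5λ²−4)t − 32λ)/(t² − 4λt + 4)⁴ dt = 0`;
the integrand is integrable on `(0,∞)` and the integral vanishes. -/
theorem stmt_14 (l : ℝ) (hl0 : 0 ≤ l) (hl1 : l < 1) :
    IntegrableOn (fun t : ℝ =>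
      (t ^ 5 + 2 * l * t ^ 4 + 8 * (l ^ 2 - 5) * t ^ 3 - 8 * l * (l ^ 2 - 9) * t ^ 2
        - 16 * (5 * l ^ 2 - 4) * t - 32 * l) / (t ^ 2 - 4 * l * t + 4) ^ 4)
      (Set.Ioi 0) volume ∧
    ∫ t in Set.Ioi (0 : ℝ),
      (t ^ 5 + 2 * l * t ^ 4 + 8 * (l ^ 2 - 5) * t ^ 3 - 8 * l * (l ^ 2 - 9) * t ^ 2
        - 16 * (5 * l ^ 2 - 4) * t - 32 * l) / (t ^ 2 - 4 * l * t + 4) ^ 4 = 0 := by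
  have h_int : IntegrableOn (fun t : ℝ =>
      (t ^ 5 + 2 * l * t ^ 4 + 8 * (l ^ 2 - 5) * t ^ 3 - 8 * l * (l ^ 2 - 9) * t ^ 2
        - 16 * (5 * l ^ 2 - 4) * t - 32 * l) / (t ^ 2 - 4 * l * t + 4) ^ 4)
      (Set.Ioi 0) volume := by
    refine Integrable.mono' (integrable_inv_one_add_sq.integrableOn.const_mul
      (211 / (1 - l) ^ (3 + 1))) ?_ ?_
    · refine (Continuous.div (by fun_prop) (by fun_prop) fun t =>
        pow_ne_zero 4 (quadratic_pos hl0 hl1 t).ne').aestronglyMeasurable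
    · exact (ae_restrict_mem measurableSet_Ioi).mono fun t ht =>
        abs_div_quadratic_pow_le hl0 hl1 (abs_numerator_le hl0 hl1 (le_of_lt ht))
  refine ⟨h_int, ?_⟩
  rw [integral_Ioi_of_hasDerivAt_of_tendsto' (fun t _ => hasDerivAt_primitive hl0 hl1 t) h_int
    (tendsto_primitive hl0 hl1)]
  norm_num
end

section
/- Fix λ ∈ [0,1), an integer s ≥ 1, and a real polynomial p of degree at most 2s + 1. For every real x, both of the following integrals converge and are equal: ∫ₓ^∞ p(t)/Z(t)^{3s+2} dt = (1/(4(1 − λ²)))·∫_{β(x)}^{1} p(τ(b))·((1 − b²)/(4(1 − λ²)))^{(3s−1)/2} db, where τ(b) = 2λ + 2b·√((1 − λ²)/(1 − b²)) for b ∈ (−1, 1). -/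
open MeasureTheory

/-- If `z² = u² + c` with `c > 0`, then `u / z` has derivative `c / z³`. -/
lemma hasDerivAt_div_sqrt_sq_add {a c : ℝ} (hc : 0 < c) (t : ℝ) :
    HasDerivAt (fun t => (t - a) / √((t - a) ^ 2 + c)) (c / √((t - a) ^ 2 + c) ^ 3) t := by
  have hpos : 0 < (t - a) ^ 2 + c := by positivity
  have hz : 0 < √((t - a) ^ 2 + c) := Real.sqrt_pos.2 hpos
  have hsq := Real.sq_sqrt hpos.le
  have hu : HasDerivAt (fun t : ℝ => t - a) 1 t := (hasDerivAt_id t).sub_const a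
  refine (hu.div (((hu.pow 2).add_const c).sqrt hpos.ne') hz.ne').congr_deriv ?_
  simp only [Pi.pow_apply]
  field_simp
  push_cast
  linear_combination 2 * hsq

lemma strictMono_div_sqrt_sq_add {a c : ℝ} (hc : 0 < c) :
    StrictMono (fun t => (t - a) / √((t - a) ^ 2 + c)) := by
  refine strictMono_of_deriv_pos fun t => ?_
  rw [(hasDerivAt_div_sqrt_sq_add hc t).deriv]
  have : 0 < (t - a) ^ 2 + c := by positivity
  positivity

/-- A polynomial divided by a power of `√((t - a)² + c)` is integrable at infinity when the power
exceeds the degree by at least two. -/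
lemma Polynomial.integrableOn_Ioi_eval_div_sqrt_pow {a c : ℝ} (hc : 0 < c) {p : Polynomial ℝ}
    {n : ℕ} (hp : p.natDegree + 2 ≤ n) (x : ℝ) :
    IntegrableOn (fun t => p.eval t / √((t - a) ^ 2 + c) ^ n) (Set.Ioi x) := by
  have hpos (t : ℝ) : 0 < √((t - a) ^ 2 + c) := by positivity
  have hcont : Continuous (fun t => p.eval t / √((t - a) ^ 2 + c) ^ n) :=
    p.continuous.div (by fun_prop) fun t => (pow_pos (hpos t) n).ne'
  have hid : (fun t : ℝ => t) =O[Filter.atTop] (fun t => √((t - a) ^ 2 + c)) := by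
    refine Asymptotics.IsBigO.of_bound 2 ?_
    filter_upwards [Filter.eventually_ge_atTop (2 * |a|)] with t ht
    have ha := abs_nonneg a
    have h1 : t - a ≤ √((t - a) ^ 2 + c) := Real.le_sqrt_of_sq_le (by linarith)
    rw [Real.norm_of_nonneg (by linarith), Real.norm_of_nonneg (hpos t).le]
    linarith [le_abs_self a]
  have hpoly : (fun t => p.eval t) =O[Filter.atTop] (fun t : ℝ => t ^ (n - 2)) := by
    have := Polynomial.isBigO_atTop_of_degree_le p (Polynomial.X ^ (n - 2)) (by
      rw [Polynomial.degree_X_pow]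
      exact Polynomial.degree_le_natDegree.trans (by exact_mod_cast (by omega)))
    simpa using this
  have hinv : (fun t => (√((t - a) ^ 2 + c) ^ n)⁻¹) =O[Filter.atTop] (fun t : ℝ => (t ^ n)⁻¹) := by
    refine (hid.pow n).inv_rev ?_
    filter_upwards [Filter.eventually_gt_atTop 0] with t ht h
    exact absurd h (pow_pos ht n).ne'
  have hO : (fun t => p.eval t / √((t - a) ^ 2 + c) ^ n) =O[Filter.atTop]
      (fun t : ℝ => t ^ (-2 : ℝ)) := by
    refine (hpoly.mul hinv).congr' (by simp [div_eq_mul_inv]) ?_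
    filter_upwards [Filter.eventually_gt_atTop 0] with t ht
    obtain ⟨k, rfl⟩ := Nat.exists_eq_add_of_le (show 2 ≤ n by omega)
    rw [Real.rpow_neg ht.le, Real.rpow_two, Nat.add_sub_cancel_left, pow_add]
    field_simp
  refine ((hcont.locallyIntegrable.locallyIntegrableOn _).integrableOn_of_isBigO_atTop hO
    ⟨Set.Ioi 1, Filter.Ioi_mem_atTop 1, ?_⟩).mono_set Set.Ioi_subset_Ici_self
  exact integrableOn_Ioi_rpow_of_lt (by norm_num) one_pos

/-- For `b ∈ (-1, 1)`, the point `t` with `t - a = 2 b √(d / (1 - b²))` is sent to `b` by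
`t ↦ (t - a) / √((t - a)² + 4 d)`. -/
lemma div_sqrt_sq_add_apply_inverse {d b : ℝ} (hd : 0 < d) (hb : b ^ 2 < 1) :
    2 * b * √(d / (1 - b ^ 2)) / √((2 * b * √(d / (1 - b ^ 2))) ^ 2 + 4 * d) = b := by
  have hb' : 0 < 1 - b ^ 2 := by linarith
  have hw : 0 < √(d / (1 - b ^ 2)) := by positivity
  have hsq : √(d / (1 - b ^ 2)) ^ 2 * (1 - b ^ 2) = d := by
    rw [Real.sq_sqrt (by positivity)]
    field_simp
  rw [show (2 * b * √(d / (1 - b ^ 2))) ^ 2 + 4 * d = (2 * √(d / (1 - b ^ 2))) ^ 2 by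
    linear_combination -4 * hsq, Real.sqrt_sq (by positivity)]
  field_simp

lemma image_Ioi_div_sqrt_sq_add {a d : ℝ} (hd : 0 < d) (x : ℝ) :
    (fun t => (t - a) / √((t - a) ^ 2 + 4 * d)) '' Set.Ioi x =
      Set.Ioo ((x - a) / √((x - a) ^ 2 + 4 * d)) 1 := by
  have hmono := strictMono_div_sqrt_sq_add (a := a) (c := 4 * d) (by positivity)
  have habs (t : ℝ) : |t - a| < √((t - a) ^ 2 + 4 * d) :=
    Real.lt_sqrt_of_sq_lt (by rw [sq_abs]; linarith)
  have hpos (t : ℝ) : 0 < √((t - a) ^ 2 + 4 * d) := by positivity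
  ext b
  constructor
  · rintro ⟨t, ht, rfl⟩
    exact ⟨hmono ht, (div_lt_one (hpos t)).2 ((le_abs_self _).trans_lt (habs t))⟩
  · rintro ⟨hb1, hb2⟩
    have hx : -1 < (x - a) / √((x - a) ^ 2 + 4 * d) := by
      rw [lt_div_iff₀ (hpos x)]
      linarith [neg_abs_le (x - a), habs x]
    have hb : b ^ 2 < 1 := by nlinarith
    have hinv : (fun t => (t - a) / √((t - a) ^ 2 + 4 * d))
        (a + 2 * b * √(d / (1 - b ^ 2))) = b := by
      simpa using div_sqrt_sq_add_apply_inverse hd hb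
    exact ⟨_, hmono.lt_iff_lt.1 (hb1.trans_eq hinv.symm), hinv⟩

/-- For `λ ∈ [0,1)`, integer `s ≥ 1`, and a real polynomial `p` of degree
at most `2s + 1`, for every real `x` both integrals converge and
`∫ₓ^∞ p(t)/Z(t)^{3s+2} dt
  = (1/(4(1−λ²)))·∫_{β(x)}^1 p(τ(b))·((1−b²)/(4(1−λ²)))^{(3s−1)/2} db`,
where `τ(b) = 2λ + 2b√((1−λ²)/(1−b²))`. -/
theorem stmt_16 (l : ℝ) (hl0 : 0 ≤ l) (hl1 : l < 1)
    (s : ℕ) (hs : 1 ≤ s) (p : Polynomial ℝ) (hp : p.natDegree ≤ 2 * s + 1)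
    (Z β : ℝ → ℝ) (τ : ℝ → ℝ)
    (hZ : ∀ x : ℝ, Z x = Real.sqrt (x ^ 2 - 4 * l * x + 4))
    (hβ : ∀ x : ℝ, β x = (x - 2 * l) / Z x)
    (hτ : ∀ b : ℝ, τ b = 2 * l + 2 * b * Real.sqrt ((1 - l ^ 2) / (1 - b ^ 2))) :
    ∀ x : ℝ,
      IntegrableOn (fun t => p.eval t / (Z t) ^ (3 * s + 2)) (Set.Ioi x) volume ∧
      IntervalIntegrable (fun b =>
        p.eval (τ b) * ((1 - b ^ 2) / (4 * (1 - l ^ 2))) ^ ((3 * (s : ℝ) - 1) / 2))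
        volume (β x) 1 ∧
      ∫ t in Set.Ioi x, p.eval t / (Z t) ^ (3 * s + 2)
        = (1 / (4 * (1 - l ^ 2))) *
          ∫ b in (β x)..1,
            p.eval (τ b) * ((1 - b ^ 2) / (4 * (1 - l ^ 2))) ^ ((3 * (s : ℝ) - 1) / 2) := by
  intro x
  have hd : 0 < 1 - l ^ 2 := by nlinarith
  have hZ' : Z = fun t => √((t - 2 * l) ^ 2 + 4 * (1 - l ^ 2)) := by
    funext t
    rw [hZ]
    ring_nf
  have hβ' : β = fun t => (t - 2 * l) / √((t - 2 * l) ^ 2 + 4 * (1 - l ^ 2)) := by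
    funext t
    rw [hβ, hZ']
  have hZpos (t : ℝ) : 0 < Z t := by
    rw [hZ']
    positivity
  have hZsq (t : ℝ) : Z t ^ 2 = (t - 2 * l) ^ 2 + 4 * (1 - l ^ 2) := by
    rw [hZ']
    exact Real.sq_sqrt (by positivity)
  have hint : IntegrableOn (fun t => p.eval t / (Z t) ^ (3 * s + 2)) (Set.Ioi x) volume := by
    rw [hZ']
    exact p.integrableOn_Ioi_eval_div_sqrt_pow (by positivity) (by omega) x
  have hderiv (t : ℝ) : HasDerivAt β (4 * (1 - l ^ 2) / Z t ^ 3) t := by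
    rw [hβ', hZ']
    exact hasDerivAt_div_sqrt_sq_add (by positivity) t
  have hmono : StrictMono β := hβ' ▸ strictMono_div_sqrt_sq_add (by positivity)
  have himage : β '' Set.Ioi x = Set.Ioo (β x) 1 := by
    rw [hβ']
    exact image_Ioi_div_sqrt_sq_add hd x
  have hle : β x ≤ 1 := by
    have : (Set.Ioo (β x) 1).Nonempty := himage ▸ Set.nonempty_Ioi.image β
    exact (Set.nonempty_Ioo.1 this).le
  have hsub (t : ℝ) : 1 - β t ^ 2 = 4 * (1 - l ^ 2) / Z t ^ 2 := by
    have := hZpos t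
    rw [hβ]
    field_simp
    linear_combination hZsq t
  have hτβ (t : ℝ) : τ (β t) = t := by
    have := hZpos t
    rw [hτ, hsub, show (1 - l ^ 2) / (4 * (1 - l ^ 2) / Z t ^ 2) = (Z t / 2) ^ 2 by
      field_simp; norm_num, Real.sqrt_sq (by positivity), hβ]
    field_simp
    ring
  have hweight (t : ℝ) : ((1 - β t ^ 2) / (4 * (1 - l ^ 2))) ^ ((3 * (s : ℝ) - 1) / 2) =
      (Z t ^ (3 * s - 1))⁻¹ := by
    have := hZpos t
    rw [hsub, show 4 * (1 - l ^ 2) / Z t ^ 2 / (4 * (1 - l ^ 2)) = (Z t)⁻¹ ^ (2 : ℝ) by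
      rw [Real.rpow_two]; field_simp, ← Real.rpow_mul (by positivity), ← inv_pow,
      ← Real.rpow_natCast, Nat.cast_sub (by omega)]
    congr 1
    push_cast
    ring
  have hsubst (t : ℝ) : (4 * (1 - l ^ 2) / Z t ^ 3) • (p.eval (τ (β t)) *
      ((1 - β t ^ 2) / (4 * (1 - l ^ 2))) ^ ((3 * (s : ℝ) - 1) / 2)) =
      4 * (1 - l ^ 2) * (p.eval t / Z t ^ (3 * s + 2)) := by
    have := hZpos t
    rw [hτβ, hweight, smul_eq_mul, show 3 * s + 2 = 3 + (3 * s - 1) by omega, pow_add]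
    field_simp
  refine ⟨hint, ?_, ?_⟩
  · rw [intervalIntegrable_iff_integrableOn_Ioo_of_le hle, ← himage,
      integrableOn_image_iff_integrableOn_deriv_smul_of_monotoneOn measurableSet_Ioi
        (fun t _ => (hderiv t).hasDerivWithinAt) (hmono.monotone.monotoneOn _)]
    simp only [hsubst]
    exact hint.const_mul _
  · rw [intervalIntegral.integral_of_le hle, integral_Ioc_eq_integral_Ioo, ← himage,
      integral_image_eq_integral_deriv_smul_of_monotoneOn measurableSet_Ioi
        (fun t _ => (hderiv t).hasDerivWithinAt) (hmono.monotone.monotoneOn _)]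
    simp only [hsubst]
    rw [integral_const_mul]
    field_simp
end

section
/- Fix λ ∈ [0,1). As the real parameter μ → +∞, μ·ln[ ((1 − λ)/(1 + λ))^μ · (e²/(μ²(1 − λ²)))^{λμ} · Γ(μ + λμ + ½)/Γ(μ − λμ + ½) ] → λ/(12(1 − λ²)). In particular the bracketed quantity tends to 1 as μ → +∞. (This is the leading term of the formal expansion determining the constants Ê⁺_{2s+1}(∞), with 2·Ê⁺₁(∞) = λ/(12(1 − λ²)).) -/
open Filter

/-- The remainder `log Γ(z + ½) - z log z + z` of the shifted Stirling approximation. -/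
noncomputable def shiftedStirlingRemainder (z : ℝ) : ℝ :=
  Real.log (Real.Gamma (z + 1 / 2)) - z * Real.log z + z

lemma log_Gamma_add_one {y : ℝ} (hy : 0 < y) :
    Real.log (Real.Gamma (y + 1)) = Real.log (Real.Gamma y) + Real.log y := by
  rw [Real.Gamma_add_one hy.ne', Real.log_mul hy.ne' (Real.Gamma_pos_of_pos hy).ne', add_comm]

lemma tendsto_log_Gamma_add_nat_sub {x : ℝ} (hx : 0 < x) :
    Tendsto (fun n : ℕ => Real.log (Real.Gamma (x + n + 1)) - x * Real.log n -
      Real.log (n.factorial : ℝ)) atTop (nhds 0) := by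
  have h := (Real.BohrMollerup.tendsto_log_gamma hx).const_sub (Real.log (Real.Gamma x))
  rw [sub_self] at h
  refine h.congr fun n => ?_
  have key := Real.BohrMollerup.f_add_nat_eq (f := Real.log ∘ Real.Gamma)
    (fun {y} hy => log_Gamma_add_one hy) hx (n + 1)
  simp only [Function.comp_apply] at key
  push_cast at key
  rw [← add_assoc] at key
  rw [key, Real.BohrMollerup.logGammaSeq]
  ring

lemma tendsto_shiftedStirlingRemainder_add_nat {z : ℝ} (hz : 0 < z) :
    Tendsto (fun n : ℕ => shiftedStirlingRemainder (z + n)) atTop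
      (nhds (Real.log (2 * Real.pi) / 2)) := by
  rw [← tendsto_add_atTop_iff_nat 1]
  have hstirling : Tendsto (fun n : ℕ => Real.log (Stirling.stirlingSeq n)) atTop
      (nhds (Real.log √Real.pi)) :=
    (Real.continuousAt_log (by positivity)).tendsto.comp Stirling.tendsto_stirlingSeq_sqrt_pi
  have hmul : Tendsto (fun n : ℕ => (n : ℝ) * Real.log (1 + (z + 1) / n)) atTop
      (nhds (z + 1)) :=
    (Real.tendsto_mul_log_one_add_div_atTop (z + 1)).comp tendsto_natCast_atTop_atTop
  have hlog : Tendsto (fun n : ℕ => (z + 1) * Real.log (1 + (z + 1) / n)) atTop (nhds 0) := by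
    have h1 : Tendsto (fun n : ℕ => 1 + (z + 1) / (n : ℝ)) atTop (nhds (1 + 0)) :=
      (tendsto_const_div_atTop_nhds_zero_nat (z + 1)).const_add 1
    rw [add_zero] at h1
    have h2 := ((Real.continuousAt_log one_ne_zero).tendsto.comp h1).const_mul (z + 1)
    simpa using h2
  have h := (((tendsto_log_Gamma_add_nat_sub (x := z + 1 / 2) (by positivity)).add
    hstirling).sub (hmul.add hlog)).add_const (Real.log 2 / 2 + z + 1)
  have hval : 0 + Real.log √Real.pi - (z + 1 + 0) + (Real.log 2 / 2 + z + 1) =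
      Real.log (2 * Real.pi) / 2 := by
    rw [Real.log_sqrt Real.pi_pos.le, Real.log_mul two_ne_zero Real.pi_ne_zero]
    ring
  rw [hval] at h
  refine h.congr' ?_
  filter_upwards [eventually_gt_atTop 0] with n hn
  have hn' : (0 : ℝ) < n := Nat.cast_pos.mpr hn
  have hsplit : Real.log (z + (n + 1)) = Real.log n + Real.log (1 + (z + 1) / n) := by
    rw [← Real.log_mul hn'.ne' (by positivity)]
    congr 1
    field_simp
    ring
  rw [Stirling.log_stirlingSeq_formula, shiftedStirlingRemainder]
  push_cast
  rw [hsplit, Real.log_mul two_ne_zero hn'.ne', Real.log_div hn'.ne' (Real.exp_ne_zero 1),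
    Real.log_exp, show z + ((n : ℝ) + 1) + 1 / 2 = z + 1 / 2 + n + 1 by ring]
  ring

lemma exists_log_one_add_eq {x : ℝ} (hx0 : x ≠ 0) (hx : |x| ≤ 1 / 2) :
    ∃ p : ℝ, |p| ≤ 2 ∧
      Real.log (1 + x) = x - x ^ 2 / 2 + x ^ 3 / 3 - x ^ 4 / 4 + p * x ^ 5 := by
  have h5 : 0 < |x| ^ 5 := by positivity
  have h := Real.abs_log_sub_add_sum_range_le (x := -x) (by rw [abs_neg]; linarith) 4
  have htail : |x| ^ 5 / (1 - |x|) ≤ 2 * |x| ^ 5 := by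
    rw [div_le_iff₀ (by linarith)]
    nlinarith
  rw [abs_neg] at h
  replace h := h.trans htail
  norm_num [Finset.sum_range_succ] at h
  refine ⟨(Real.log (1 + x) - (x - x ^ 2 / 2 + x ^ 3 / 3 - x ^ 4 / 4)) / x ^ 5, ?_, ?_⟩
  · rw [abs_div, abs_pow, div_le_iff₀ h5]
    refine le_of_eq_of_le ?_ h
    congr 1
    ring
  · field_simp
    ring

/-- The increment of `z ↦ shiftedStirlingRemainder z + 1 / (24 z)` has size `O(z⁻³)`. -/
lemma abs_shiftedStirlingRemainder_increment_le {z : ℝ} (hz : 1 / 2 ≤ z) :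
    |(shiftedStirlingRemainder z + 1 / (24 * z)) -
      (shiftedStirlingRemainder (z + 1) + 1 / (24 * (z + 1)))| ≤
      1 / z ^ 2 - 1 / (z + 1) ^ 2 := by
  have hz0 : 0 < z := by linarith
  obtain ⟨u, hu⟩ : ∃ u : ℝ, u = 1 / (2 * z + 1) := ⟨_, rfl⟩
  have hu0 : 0 < u := by rw [hu]; positivity
  have hu1 : u ≤ 1 / 2 := by
    rw [hu]
    exact one_div_le_one_div_of_le two_pos (by linarith)
  have hzu : z = (1 - u) / (2 * u) := by rw [hu]; field_simp; ring
  have hz1u : z + 1 = (1 + u) / (2 * u) := by rw [hu]; field_simp; ring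
  have hw : z + 1 / 2 = 1 / (2 * u) := by rw [hu]; field_simp
  have hlogz : Real.log z = Real.log (z + 1 / 2) + Real.log (1 - u) := by
    rw [← Real.log_mul (by positivity) (by linarith), hw, hzu]
    congr 1; ring
  have hlogz1 : Real.log (z + 1) = Real.log (z + 1 / 2) + Real.log (1 + u) := by
    rw [← Real.log_mul (by positivity) (by linarith), hw, hz1u]
    congr 1; ring
  have hinc : (shiftedStirlingRemainder z + 1 / (24 * z)) -
      (shiftedStirlingRemainder (z + 1) + 1 / (24 * (z + 1))) =
      (1 + u) / (2 * u) * Real.log (1 + u) - (1 - u) / (2 * u) * Real.log (1 - u) - 1 +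
        u ^ 2 / (6 * (1 - u ^ 2)) := by
    have hrat : 1 / (24 * z) - 1 / (24 * (z + 1)) = u ^ 2 / (6 * (1 - u ^ 2)) := by
      have h1 : 1 - u ≠ 0 := by linarith
      have h2 : 1 + u ≠ 0 := by linarith
      rw [hz1u, hzu, show 1 - u ^ 2 = (1 - u) * (1 + u) by ring]
      field_simp
      ring
    rw [← hrat, ← hzu, ← hz1u, shiftedStirlingRemainder, shiftedStirlingRemainder,
      show z + 1 + 1 / 2 = z + 1 / 2 + 1 by ring, log_Gamma_add_one (by positivity),
      hlogz1, hlogz]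
    ring
  have hupper : 16 * u ^ 3 ≤ 1 / z ^ 2 - 1 / (z + 1) ^ 2 := by
    have h1 : 0 < 1 - u := by linarith
    have h2 : 0 < 1 + u := by linarith
    have heq : 1 / z ^ 2 - 1 / (z + 1) ^ 2 = 16 * u ^ 3 / ((1 - u) * (1 + u)) ^ 2 := by
      rw [hz1u, hzu]
      field_simp
      ring
    rw [heq, le_div_iff₀ (by positivity)]
    have h3 : ((1 - u) * (1 + u)) ^ 2 ≤ 1 := by
      apply pow_le_one₀ (by positivity)
      nlinarith
    exact mul_le_of_le_one_right (by positivity) h3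
  obtain ⟨p, hpb, hp⟩ := exists_log_one_add_eq (x := u) hu0.ne' (by rwa [abs_of_pos hu0])
  obtain ⟨q, hqb, hq⟩ := exists_log_one_add_eq (x := -u) (neg_ne_zero.mpr hu0.ne')
    (by rwa [abs_neg, abs_of_pos hu0])
  rw [← sub_eq_add_neg] at hq
  rw [hinc, hp, hq]
  refine le_trans ?_ hupper
  have h1 : 0 < 1 - u ^ 2 := by nlinarith
  have hexp : (1 + u) / (2 * u) * (u - u ^ 2 / 2 + u ^ 3 / 3 - u ^ 4 / 4 + p * u ^ 5) -
      (1 - u) / (2 * u) * (-u - (-u) ^ 2 / 2 + (-u) ^ 3 / 3 - (-u) ^ 4 / 4 + q * (-u) ^ 5) - 1 +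
        u ^ 2 / (6 * (1 - u ^ 2)) =
      u ^ 3 * (u * (-1 / 4 + (1 + u) * p / 2 + (1 - u) * q / 2 + 1 / (6 * (1 - u ^ 2)))) := by
    field_simp
    ring
  have hr : 1 / (6 * (1 - u ^ 2)) ≤ 1 := by
    rw [div_le_one (by positivity)]
    nlinarith
  have hr0 : 0 ≤ 1 / (6 * (1 - u ^ 2)) := by positivity
  rw [hexp, abs_mul, abs_of_pos (show 0 < u ^ 3 by positivity), mul_comm 16]
  refine mul_le_mul_of_nonneg_left ?_ (by positivity)
  obtain ⟨hp1, hp2⟩ := abs_le.mp hpb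
  obtain ⟨hq1, hq2⟩ := abs_le.mp hqb
  have hu2 : 0 ≤ 1 + u := by linarith
  have hu3 : 0 ≤ 1 - u := by linarith
  have hp3 := mul_le_mul_of_nonneg_left hp1 hu2
  have hp4 := mul_le_mul_of_nonneg_left hp2 hu2
  have hq3 := mul_le_mul_of_nonneg_left hq1 hu3
  have hq4 := mul_le_mul_of_nonneg_left hq2 hu3
  have hbr : |-1 / 4 + (1 + u) * p / 2 + (1 - u) * q / 2 + 1 / (6 * (1 - u ^ 2))| ≤ 16 := by
    rw [abs_le]
    constructor <;> linarith
  rw [abs_mul, abs_of_pos hu0]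
  exact (mul_le_of_le_one_left (abs_nonneg _) (by linarith)).trans hbr

lemma tendsto_one_div_mul_add_nat_pow (a z : ℝ) (ha : 0 < a) {k : ℕ} (hk : k ≠ 0) :
    Tendsto (fun n : ℕ => 1 / (a * (z + n) ^ k)) atTop (nhds 0) := by
  have h : Tendsto (fun n : ℕ => z + (n : ℝ)) atTop atTop :=
    tendsto_atTop_add_const_left _ z tendsto_natCast_atTop_atTop
  exact tendsto_const_nhds.div_atTop (((tendsto_pow_atTop hk).comp h).const_mul_atTop ha)

lemma abs_shiftedStirlingRemainder_sub_le {z : ℝ} (hz : 1 / 2 ≤ z) :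
    |shiftedStirlingRemainder z + 1 / (24 * z) - Real.log (2 * Real.pi) / 2| ≤ 1 / z ^ 2 := by
  have hz0 : 0 < z := by linarith
  have hlim : Tendsto (fun n : ℕ => shiftedStirlingRemainder (z + n) + 1 / (24 * (z + n)))
      atTop (nhds (Real.log (2 * Real.pi) / 2)) := by
    simpa using (tendsto_shiftedStirlingRemainder_add_nat hz0).add
      (tendsto_one_div_mul_add_nat_pow 24 z (by norm_num) one_ne_zero)
  have hsq : Tendsto (fun n : ℕ => 1 / (z + n) ^ 2) atTop (nhds 0) := by
    simpa using tendsto_one_div_mul_add_nat_pow 1 z one_pos two_ne_zero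
  have hinc (n : ℕ) := abs_le.mp (abs_shiftedStirlingRemainder_increment_le
    (z := z + n) (by linarith [n.cast_nonneg (α := ℝ)]))
  have hmono : Monotone fun n : ℕ =>
      shiftedStirlingRemainder (z + n) + 1 / (24 * (z + n)) - 1 / (z + n) ^ 2 := by
    refine monotone_nat_of_le_succ fun n => ?_
    push_cast
    rw [← add_assoc]
    linarith [(hinc n).2]
  have hanti : Antitone fun n : ℕ =>
      shiftedStirlingRemainder (z + n) + 1 / (24 * (z + n)) + 1 / (z + n) ^ 2 := by
    refine antitone_nat_of_succ_le fun n => ?_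
    push_cast
    rw [← add_assoc]
    linarith [(hinc n).1]
  have hle := hmono.ge_of_tendsto (hlim.sub hsq) 0
  have hge := hanti.le_of_tendsto (hlim.add hsq) 0
  simp only [Nat.cast_zero, add_zero, sub_zero] at hle hge
  rw [abs_le]
  constructor <;> linarith

lemma tendsto_mul_shiftedStirlingRemainder_sub :
    Tendsto (fun z : ℝ => z * (shiftedStirlingRemainder z - Real.log (2 * Real.pi) / 2)) atTop
      (nhds (-(1 / 24))) := by
  rw [← tendsto_sub_nhds_zero_iff]
  refine squeeze_zero_norm' ?_ (tendsto_inv_atTop_zero (𝕜 := ℝ))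
  filter_upwards [eventually_ge_atTop (1 / 2)] with z hz
  have hz0 : 0 < z := by linarith
  have heq : z * (shiftedStirlingRemainder z - Real.log (2 * Real.pi) / 2) - -(1 / 24) =
      z * (shiftedStirlingRemainder z + 1 / (24 * z) - Real.log (2 * Real.pi) / 2) := by
    field_simp
    ring
  rw [heq, Real.norm_eq_abs, abs_mul, abs_of_pos hz0]
  calc _ ≤ z * (1 / z ^ 2) :=
        mul_le_mul_of_nonneg_left (abs_shiftedStirlingRemainder_sub_le hz) hz0.le
    _ = z⁻¹ := by field_simp

lemma gamma_ratio_normalized_pos {l m : ℝ} (hl0 : 0 ≤ l) (hl1 : l < 1) (hm : 0 < m) :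
    0 < ((1 - l) / (1 + l)) ^ m * (Real.exp 2 / (m ^ 2 * (1 - l ^ 2))) ^ (l * m) *
      (Real.Gamma (m + l * m + 1 / 2) / Real.Gamma (m - l * m + 1 / 2)) := by
  have h1 : 0 < 1 - l := by linarith
  have h2 : 0 < 1 - l ^ 2 := by nlinarith
  have hb : 0 < m - l * m := by nlinarith
  have := Real.Gamma_pos_of_pos (show 0 < m + l * m + 1 / 2 by positivity)
  have := Real.Gamma_pos_of_pos (show 0 < m - l * m + 1 / 2 by positivity)
  positivity

lemma log_gamma_ratio_normalized {l m : ℝ} (hl0 : 0 ≤ l) (hl1 : l < 1) (hm : 0 < m) :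
    Real.log (((1 - l) / (1 + l)) ^ m * (Real.exp 2 / (m ^ 2 * (1 - l ^ 2))) ^ (l * m) *
      (Real.Gamma (m + l * m + 1 / 2) / Real.Gamma (m - l * m + 1 / 2))) =
      shiftedStirlingRemainder ((1 + l) * m) - shiftedStirlingRemainder ((1 - l) * m) := by
  have h1 : 0 < 1 - l := by linarith
  have h3 : 0 < 1 + l := by linarith
  have h2 : 0 < (1 - l) * (1 + l) := by positivity
  have ha := Real.Gamma_pos_of_pos (show 0 < (1 + l) * m + 1 / 2 by positivity)
  have hb := Real.Gamma_pos_of_pos (show 0 < (1 - l) * m + 1 / 2 by positivity)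
  rw [show m + l * m = (1 + l) * m by ring, show m - l * m = (1 - l) * m by ring,
    show 1 - l ^ 2 = (1 - l) * (1 + l) by ring,
    Real.log_mul (by positivity) (by positivity), Real.log_mul (by positivity) (by positivity),
    Real.log_rpow (by positivity), Real.log_rpow (by positivity),
    Real.log_div h1.ne' h3.ne', Real.log_div (Real.exp_ne_zero 2) (by positivity), Real.log_exp,
    Real.log_mul (by positivity) (by positivity), Real.log_mul h1.ne' h3.ne',
    Real.log_pow, Real.log_div ha.ne' hb.ne', shiftedStirlingRemainder,
    shiftedStirlingRemainder, Real.log_mul h1.ne' hm.ne', Real.log_mul h3.ne' hm.ne']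
  push_cast
  ring

/-- For `λ ∈ [0,1)`, as `μ → +∞`,
`μ·ln[((1−λ)/(1+λ))^μ (e²/(μ²(1−λ²)))^{λμ} Γ(μ+λμ+½)/Γ(μ−λμ+½)] → λ/(12(1−λ²))`,
and in particular the bracketed quantity tends to `1`. -/
theorem stmt_17 (l : ℝ) (hl0 : 0 ≤ l) (hl1 : l < 1) :
    Tendsto (fun μ : ℝ => μ * Real.log
      (((1 - l) / (1 + l)) ^ μ * (Real.exp 2 / (μ ^ 2 * (1 - l ^ 2))) ^ (l * μ) *
        (Real.Gamma (μ + l * μ + 1 / 2) / Real.Gamma (μ - l * μ + 1 / 2))))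
      atTop (nhds (l / (12 * (1 - l ^ 2)))) ∧
    Tendsto (fun μ : ℝ =>
      ((1 - l) / (1 + l)) ^ μ * (Real.exp 2 / (μ ^ 2 * (1 - l ^ 2))) ^ (l * μ) *
        (Real.Gamma (μ + l * μ + 1 / 2) / Real.Gamma (μ - l * μ + 1 / 2)))
      atTop (nhds 1) := by
  have h1 : 0 < 1 - l := by linarith
  have h2 : 0 < 1 + l := by linarith
  have hscaled {c : ℝ} (hc : 0 < c) : Tendsto
      (fun μ : ℝ => μ * (shiftedStirlingRemainder (c * μ) - Real.log (2 * Real.pi) / 2)) atTop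
      (nhds (c⁻¹ * -(1 / 24))) := by
    refine ((tendsto_mul_shiftedStirlingRemainder_sub.comp
      (tendsto_id.const_mul_atTop hc)).const_mul c⁻¹).congr fun μ => ?_
    simp only [Function.comp_apply, id_eq]
    field_simp
  have hmain : Tendsto (fun μ : ℝ => μ * Real.log
      (((1 - l) / (1 + l)) ^ μ * (Real.exp 2 / (μ ^ 2 * (1 - l ^ 2))) ^ (l * μ) *
        (Real.Gamma (μ + l * μ + 1 / 2) / Real.Gamma (μ - l * μ + 1 / 2))))
      atTop (nhds (l / (12 * (1 - l ^ 2)))) := by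
    have hval : (1 + l)⁻¹ * -(1 / 24) - (1 - l)⁻¹ * -(1 / 24) = l / (12 * (1 - l ^ 2)) := by
      rw [show 1 - l ^ 2 = (1 - l) * (1 + l) by ring]
      field_simp
      ring
    rw [← hval]
    refine ((hscaled h2).sub (hscaled h1)).congr' ?_
    filter_upwards [eventually_gt_atTop 0] with μ hμ
    rw [log_gamma_ratio_normalized hl0 hl1 hμ]
    ring
  refine ⟨hmain, ?_⟩
  have hexp := (Real.continuous_exp.tendsto 0).comp (hmain.div_atTop tendsto_id)
  rw [Real.exp_zero] at hexp
  refine hexp.congr' ?_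
  filter_upwards [eventually_gt_atTop 0] with μ hμ
  simp only [Function.comp_apply, id_eq]
  rw [mul_div_cancel_left₀ _ hμ.ne', Real.exp_log (gamma_ratio_normalized_pos hl0 hl1 hμ)]
end

section
/- Fix λ ∈ [0,1). As the real parameter μ → +∞, μ·ln[ (e/(4μ))^μ · (μ/e)^{λμ} · (1 + λ)^{μ + λμ} · Γ(2μ + 1)/(√(2μ)·Γ(μ + λμ + ½)) ] → (2 + λ)/(24(1 + λ)). In particular the bracketed quantity tends to 1 as μ → +∞. (This is the leading term of the formal expansion determining the connection constants k_{2m+1}, with k₁ = (2 + λ)/(24(1 + λ)).) -/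
open Filter Real Topology

/-- The remainder `log Γ(x) - ((x - 1/2) log x - x + log (2π) / 2)` in Stirling's formula. -/
noncomputable def stirlingRemainder (x : ℝ) : ℝ :=
  log (Gamma x) - ((x - 1 / 2) * log x - x + 1 / 2 * log (2 * π))

lemma hasSum_add_half_mul_log_sub_one {x : ℝ} (hx : 0 < x) :
    HasSum (fun k : ℕ => 1 / (2 * (k : ℝ) + 3) * ((1 / (2 * x + 1)) ^ 2) ^ (k + 1))
      ((x + 1 / 2) * log (1 + x⁻¹) - 1) := by
  let f (k : ℕ) : ℝ := 1 / (2 * k + 1) * ((1 / (2 * x + 1)) ^ 2) ^ k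
  have hf : HasSum f ((x + 1 / 2) * log (1 + x⁻¹)) := by
    convert! (hasSum_log_one_add_inv hx).mul_left (x + 1 / 2) using 1
    ext k
    dsimp only [f]
    rw [← pow_mul, pow_add]
    field
  have h := (hasSum_nat_add_iff' 1).2 hf
  convert! h using 1
  · ext k
    simp only [f]
    push_cast
    ring
  · simp [f]

lemma add_half_mul_log_sub_one_le {x : ℝ} (hx : 0 < x) :
    (x + 1 / 2) * log (1 + x⁻¹) - 1 ≤ 1 / (12 * x) - 1 / (12 * (x + 1)) := by
  set t : ℝ := (1 / (2 * x + 1)) ^ 2 with ht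
  have ht0 : 0 ≤ t := sq_nonneg _
  have ht1 : t < 1 := by
    rw [ht, one_div, inv_pow]
    exact inv_lt_one_of_one_lt₀ (one_lt_pow₀ (by linarith) two_ne_zero)
  have hg : HasSum (fun k : ℕ => 1 / 3 * t * t ^ k) (1 / 3 * t * (1 - t)⁻¹) :=
    (hasSum_geometric_of_lt_one ht0 ht1).mul_left _
  refine (hasSum_le (fun k => ?_) (hasSum_add_half_mul_log_sub_one hx) hg).trans_eq ?_
  · rw [pow_succ', mul_assoc]
    gcongr
    linarith [(Nat.cast_nonneg k : (0 : ℝ) ≤ k)]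
  · have h : 1 - t = 4 * x * (x + 1) / (2 * x + 1) ^ 2 := by
      rw [ht]; field_simp; ring
    rw [h, ht]
    field_simp
    ring

lemma le_add_half_mul_log_sub_one {x : ℝ} (hx : 0 < x) :
    1 / (12 * (x + 1 / 2)) - 1 / (12 * (x + 1 + 1 / 2)) ≤ (x + 1 / 2) * log (1 + x⁻¹) - 1 := by
  have h := le_hasSum (hasSum_add_half_mul_log_sub_one hx) 0 fun k _ => by positivity
  refine le_trans ?_ h
  have e : 1 / (12 * (x + 1 / 2)) - 1 / (12 * (x + 1 + 1 / 2))
      = 1 / (3 * ((2 * x + 1) * (2 * x + 3))) := by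
    field_simp
    ring
  rw [e]
  have e' : 1 / (2 * ((0 : ℕ) : ℝ) + 3) * ((1 / (2 * x + 1)) ^ 2) ^ (0 + 1)
      = 1 / (3 * ((2 * x + 1) * (2 * x + 1))) := by
    norm_num
    field
  rw [e']
  gcongr
  norm_num

lemma stirlingRemainder_sub_succ {x : ℝ} (hx : 0 < x) :
    stirlingRemainder x - stirlingRemainder (x + 1) = (x + 1 / 2) * log (1 + x⁻¹) - 1 := by
  have h : 1 + x⁻¹ = (x + 1) / x := by field
  rw [stirlingRemainder, stirlingRemainder, Gamma_add_one hx.ne',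
    log_mul hx.ne' (Gamma_pos_of_pos hx).ne', h, log_div (by positivity) hx.ne']
  ring

lemma log_Gamma_add_nat {x : ℝ} (hx : 0 < x) (n : ℕ) :
    log (Gamma (x + n)) = log (Gamma x) + ∑ m ∈ Finset.range n, log (x + m) := by
  refine BohrMollerup.f_add_nat_eq (f := log ∘ Gamma) (fun {y} hy => ?_) hx n
  rw [Function.comp_apply, Gamma_add_one hy.ne', log_mul hy.ne' (Gamma_pos_of_pos hy).ne',
    add_comm, Function.comp_apply]

lemma tendsto_stirlingRemainder_add_nat {x : ℝ} (hx : 0 < x) :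
    Tendsto (fun n : ℕ => stirlingRemainder (x + n)) atTop (𝓝 0) := by
  rw [← tendsto_add_atTop_iff_nat 1]
  have h₁ := BohrMollerup.tendsto_log_gamma hx
  have h₂ : Tendsto (fun n => log (Stirling.stirlingSeq n)) atTop (𝓝 (log √π)) :=
    Stirling.tendsto_stirlingSeq_sqrt_pi.log (by positivity)
  have h₃ : Tendsto (fun n : ℕ => (n : ℝ) * log (1 + (x + 1) / n)) atTop (𝓝 (x + 1)) :=
    (tendsto_mul_log_one_add_div_atTop (x + 1)).comp tendsto_natCast_atTop_atTop
  have h₄ : Tendsto (fun n : ℕ => log (1 + (x + 1) / n)) atTop (𝓝 0) := by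
    have h : Tendsto (fun n : ℕ => 1 + (x + 1) / n) atTop (𝓝 (1 + 0)) :=
      (tendsto_const_div_atTop_nhds_zero_nat (x + 1)).const_add 1
    simpa using h.log (by norm_num)
  have h := ((((h₁.const_sub (log (Gamma x))).add (h₂.sub_const (log √π))).sub h₃).sub
    (h₄.const_mul (x + 1 / 2))).add_const (x + 1)
  simp only [sub_self, mul_zero, sub_zero, zero_sub, add_zero, neg_add_cancel] at h
  refine h.congr' ?_
  filter_upwards [eventually_gt_atTop 0] with n hn
  have hn' : (0 : ℝ) < n := Nat.cast_pos.2 hn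
  have e : 1 + (x + 1) / n = (x + (n + 1)) / n := by field
  rw [stirlingRemainder, log_Gamma_add_nat hx, BohrMollerup.logGammaSeq,
    Stirling.log_stirlingSeq_formula, e, log_div (by positivity) hn'.ne',
    log_div hn'.ne' (exp_pos 1).ne', log_exp, log_mul two_ne_zero hn'.ne',
    log_mul two_ne_zero pi_pos.ne', log_sqrt pi_pos.le]
  push_cast
  ring

lemma stirlingRemainder_le {x : ℝ} (hx : 0 < x) : stirlingRemainder x ≤ 1 / (12 * x) := by
  have hlim : Tendsto (fun n : ℕ => 1 / (12 * (x + n))) atTop (𝓝 0) :=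
    tendsto_const_nhds.div_atTop ((tendsto_atTop_add_const_left _ x
      tendsto_natCast_atTop_atTop).const_mul_atTop (by norm_num))
  have hm : Monotone fun n : ℕ => stirlingRemainder (x + n) - 1 / (12 * (x + n)) := by
    refine monotone_nat_of_le_succ fun n => ?_
    have hp : 0 < x + n := by positivity
    have h₁ := stirlingRemainder_sub_succ hp
    have h₂ := add_half_mul_log_sub_one_le hp
    push_cast
    rw [← add_assoc]
    linarith
  have h := hm.ge_of_tendsto (by simpa using (tendsto_stirlingRemainder_add_nat hx).sub hlim) 0
  simp only [Nat.cast_zero, add_zero] at h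
  linarith

lemma le_stirlingRemainder {x : ℝ} (hx : 0 < x) :
    1 / (12 * (x + 1 / 2)) ≤ stirlingRemainder x := by
  have hlim : Tendsto (fun n : ℕ => 1 / (12 * (x + n + 1 / 2))) atTop (𝓝 0) :=
    tendsto_const_nhds.div_atTop ((tendsto_atTop_add_const_right _ _
      (tendsto_atTop_add_const_left _ x tendsto_natCast_atTop_atTop)).const_mul_atTop
      (by norm_num))
  have hm : Antitone fun n : ℕ => stirlingRemainder (x + n) - 1 / (12 * (x + n + 1 / 2)) := by
    refine antitone_nat_of_succ_le fun n => ?_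
    have hp : 0 < x + n := by positivity
    have h₁ := stirlingRemainder_sub_succ hp
    have h₂ := le_add_half_mul_log_sub_one hp
    push_cast
    rw [← add_assoc]
    linarith
  have h := hm.le_of_tendsto (by simpa using (tendsto_stirlingRemainder_add_nat hx).sub hlim) 0
  simp only [Nat.cast_zero, add_zero] at h
  linarith

lemma tendsto_mul_stirlingRemainder :
    Tendsto (fun x => x * stirlingRemainder x) atTop (𝓝 (1 / 12)) := by
  have hlim : Tendsto (fun x : ℝ => 1 / 12 - 1 / (24 * (x + 1 / 2))) atTop (𝓝 (1 / 12)) := by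
    have h : Tendsto (fun x : ℝ => 1 / (24 * (x + 1 / 2))) atTop (𝓝 0) :=
      tendsto_const_nhds.div_atTop ((tendsto_atTop_add_const_right _ _
        tendsto_id).const_mul_atTop (by norm_num))
    simpa only [sub_zero] using h.const_sub (1 / 12)
  refine tendsto_of_tendsto_of_tendsto_of_le_of_le' hlim tendsto_const_nhds ?_ ?_
  · filter_upwards [eventually_gt_atTop 0] with x hx
    calc 1 / 12 - 1 / (24 * (x + 1 / 2)) = x * (1 / (12 * (x + 1 / 2))) := by field_simp; ring
      _ ≤ x * stirlingRemainder x := by gcongr; exact le_stirlingRemainder hx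
  · filter_upwards [eventually_gt_atTop 0] with x hx
    calc x * stirlingRemainder x ≤ x * (1 / (12 * x)) := by gcongr; exact stirlingRemainder_le hx
      _ = 1 / 12 := by field

lemma tendsto_mul_stirlingRemainder_const_mul {c : ℝ} (hc : 0 < c) :
    Tendsto (fun x => x * stirlingRemainder (c * x)) atTop (𝓝 (1 / (12 * c))) := by
  have h := (tendsto_mul_stirlingRemainder.comp
    (tendsto_id.const_mul_atTop hc)).const_mul c⁻¹
  convert! h using 2
  · simp only [Function.comp_apply, id]
    field
  · field

lemma log_Gamma_add_half {y : ℝ} (hy : 0 < y) :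
    log (Gamma (y + 1 / 2)) = y * log y - y + 1 / 2 * log (2 * π)
      + (stirlingRemainder (2 * y) - stirlingRemainder y) := by
  have h := congrArg log (Gamma_mul_Gamma_add_half_of_pos hy)
  have h₁ := Gamma_pos_of_pos hy
  have h₂ := Gamma_pos_of_pos (show 0 < y + 1 / 2 by positivity)
  have h₃ := Gamma_pos_of_pos (show 0 < 2 * y by positivity)
  rw [log_mul h₁.ne' h₂.ne', log_mul (by positivity) (by positivity),
    log_mul (by positivity) (by positivity), log_rpow two_pos, log_sqrt pi_pos.le] at h
  rw [stirlingRemainder, stirlingRemainder, log_mul two_ne_zero hy.ne',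
    log_mul two_ne_zero pi_pos.ne']
  linear_combination h

/-- For `λ ∈ [0,1)`, as `μ → +∞`,
`μ·ln[(e/(4μ))^μ (μ/e)^{λμ} (1+λ)^{μ+λμ} Γ(2μ+1)/(√(2μ)Γ(μ+λμ+½))] → (2+λ)/(24(1+λ))`,
and in particular the bracketed quantity tends to `1`. -/
theorem stmt_18 (l : ℝ) (hl0 : 0 ≤ l) (hl1 : l < 1) :
    Tendsto (fun μ : ℝ => μ * Real.log
      ((Real.exp 1 / (4 * μ)) ^ μ * (μ / Real.exp 1) ^ (l * μ) *
        (1 + l) ^ (μ + l * μ) *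
        (Real.Gamma (2 * μ + 1) / (Real.sqrt (2 * μ) * Real.Gamma (μ + l * μ + 1 / 2)))))
      atTop (nhds ((2 + l) / (24 * (1 + l)))) ∧
    Tendsto (fun μ : ℝ =>
      (Real.exp 1 / (4 * μ)) ^ μ * (μ / Real.exp 1) ^ (l * μ) *
        (1 + l) ^ (μ + l * μ) *
        (Real.Gamma (2 * μ + 1) / (Real.sqrt (2 * μ) * Real.Gamma (μ + l * μ + 1 / 2))))
      atTop (nhds 1) := by
  set B : ℝ → ℝ := fun μ =>
    (Real.exp 1 / (4 * μ)) ^ μ * (μ / Real.exp 1) ^ (l * μ) * (1 + l) ^ (μ + l * μ) *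
      (Real.Gamma (2 * μ + 1) / (Real.sqrt (2 * μ) * Real.Gamma (μ + l * μ + 1 / 2))) with hB
  have hl : 0 < 1 + l := by linarith
  have hpos : ∀ μ : ℝ, 0 < μ → 0 < B μ := fun μ hμ => by
    have h₁ := Gamma_pos_of_pos (show 0 < 2 * μ + 1 by positivity)
    have h₂ := Gamma_pos_of_pos (show 0 < μ + l * μ + 1 / 2 by positivity)
    simp only [hB]
    positivity
  have hlog : ∀ μ : ℝ, 0 < μ → log (B μ) = stirlingRemainder (2 * μ)
      - stirlingRemainder (2 * (1 + l) * μ) + stirlingRemainder ((1 + l) * μ) := fun μ hμ => by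
    have h₁ := Gamma_pos_of_pos (show 0 < 2 * μ by positivity)
    have h₂ := Gamma_pos_of_pos (show 0 < μ + l * μ + 1 / 2 by positivity)
    have hy : μ + l * μ = (1 + l) * μ := by ring
    simp only [hB]
    rw [Gamma_add_one (by positivity), log_mul (by positivity) (by positivity),
      log_mul (by positivity) (by positivity), log_mul (by positivity) (by positivity),
      log_rpow (by positivity), log_rpow (by positivity), log_rpow hl,
      log_div (exp_pos 1).ne' (by positivity), log_div hμ.ne' (exp_pos 1).ne', log_exp,
      log_div (by positivity) (by positivity), log_mul (by positivity) h₁.ne',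
      log_mul (by positivity) h₂.ne', log_sqrt (by positivity), hy,
      log_Gamma_add_half (by positivity), ← mul_assoc, stirlingRemainder.eq_1 (2 * μ),
      log_mul hl.ne' hμ.ne', log_mul two_ne_zero hμ.ne', log_mul four_ne_zero hμ.ne',
      show (4 : ℝ) = 2 * 2 by norm_num, log_mul two_ne_zero two_ne_zero]
    ring
  have hmain : Tendsto (fun μ => μ * log (B μ)) atTop (𝓝 ((2 + l) / (24 * (1 + l)))) := by
    have h := ((tendsto_mul_stirlingRemainder_const_mul two_pos).sub
      (tendsto_mul_stirlingRemainder_const_mul (mul_pos two_pos hl))).add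
      (tendsto_mul_stirlingRemainder_const_mul hl)
    have hc : 1 / (12 * 2) - 1 / (12 * (2 * (1 + l))) + 1 / (12 * (1 + l))
        = (2 + l) / (24 * (1 + l)) := by
      field_simp
      ring
    rw [hc] at h
    refine h.congr' ?_
    filter_upwards [eventually_gt_atTop 0] with μ hμ
    rw [hlog μ hμ]
    ring
  refine ⟨hmain, ?_⟩
  have hzero : Tendsto (fun μ => log (B μ)) atTop (𝓝 0) := by
    refine (hmain.div_atTop tendsto_id).congr' ?_
    filter_upwards [eventually_gt_atTop 0] with μ hμ
    exact mul_div_cancel_left₀ _ hμ.ne'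
  have hexp : Tendsto (fun μ => exp (log (B μ))) atTop (𝓝 1) := by
    simpa [Function.comp_def] using (continuous_exp.tendsto 0).comp hzero
  refine hexp.congr' ?_
  filter_upwards [eventually_gt_atTop 0] with μ hμ
  exact exp_log (hpos μ hμ)
end
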